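/- arXiv:2307.02182 — 4 statements merged into one kernel-verified Lean document; each statement's English description precedes it below -/
import Mathlib

section
/- Let g be the irreducible characteristic polynomial of an m×m matrix B over GF(2), and let M₂ be an arbitrary invertible m×m matrix over GF(2) with first column v. Then there exists an m×m matrix B' over GF(2) whose characteristic polynomial equals g such that the columns of M₂ are v, B'·v, B'²·v, …, B'^(m−1)·v. In particular, every invertible m×m matrix over GF(2) is a matrix state of a sequence generated by a σ-LFSR with a single delay block whose characteristic polynomial is g. -/
/-- Let `g` be the irreducible characteristic polynomial of an `m×m` matrix `B` over `GF(2)`,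
and let `M₂` be an arbitrary invertible `m×m` matrix over `GF(2)` with first column `v`.
Then there is a matrix `B'` with characteristic polynomial `g` such that the columns of
`M₂` are `v, B'·v, …, B'^(m-1)·v`; i.e. every invertible matrix is a matrix state of a
sequence generated by a single-block σ-LFSR with characteristic polynomial `g`. -/
theorem every_fullrank_matrix_is_matrix_state (m : ℕ) (hm : 0 < m)
    (B : Matrix (Fin m) (Fin m) (ZMod 2)) (g : Polynomial (ZMod 2))
    (hg : g = B.charpoly) (hirr : Irreducible g)
    (M₂ : Matrix (Fin m) (Fin m) (ZMod 2)) (hM₂ : IsUnit M₂.det)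
    (v : Fin m → ZMod 2) (hv : M₂.mulVec (Pi.single (⟨0, hm⟩ : Fin m) 1) = v) :
    ∃ B' : Matrix (Fin m) (Fin m) (ZMod 2), B'.charpoly = g ∧
      ∀ j : Fin m, M₂.mulVec (Pi.single j 1) = (B' ^ (j : ℕ)).mulVec v := by
  subst hg
  set e : Fin m → ZMod 2 := Pi.single (⟨0, hm⟩ : Fin m) 1 with he
  have hene : e ≠ 0 := by simp [he]
  let K : Matrix (Fin m) (Fin m) (ZMod 2) := Matrix.of fun i j => ((B ^ (j : ℕ)).mulVec e) i
  have hKcol : ∀ j : Fin m, K.mulVec (Pi.single j 1) = (B ^ (j : ℕ)).mulVec e := by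
    intro j
    ext i
    simp [K]
  have hKinj : ∀ w, K.mulVec w = 0 → w = 0 := by
    intro w hw
    let p : Polynomial (ZMod 2) := ∑ j : Fin m, Polynomial.C (w j) * Polynomial.X ^ (j : ℕ)
    have hp : (Polynomial.aeval B p).mulVec e = 0 := by
      rw [← hw]
      ext i
      simp only [p, map_sum, map_mul, Polynomial.aeval_C, map_pow, Polynomial.aeval_X,
        Matrix.sum_mulVec, Finset.sum_apply, ← Algebra.smul_def, Matrix.smul_mulVec,
        Pi.smul_apply, smul_eq_mul]
      simp only [Matrix.mulVec, dotProduct, K, Matrix.of_apply]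
      exact Finset.sum_congr rfl fun j _ => mul_comm _ _
    have hdeg : p.degree < m := Polynomial.degree_sum_fin_lt w
    have hp0 : p = 0 := by
      by_contra hne
      have hnd : ¬ B.charpoly ∣ p := by
        intro hd
        have h1 := Polynomial.degree_le_of_dvd hd hne
        rw [Matrix.charpoly_degree_eq_dim, Fintype.card_fin] at h1
        exact absurd hdeg (not_lt.mpr h1)
      obtain ⟨a, b, hab⟩ := (hirr.coprime_iff_not_dvd).2 hnd
      have h2 := congrArg (fun q => (Polynomial.aeval B q).mulVec e) hab
      simp only [map_add, map_mul, Matrix.aeval_self_charpoly, mul_zero, zero_add, map_one,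
        Matrix.one_mulVec, ← Matrix.mulVec_mulVec, hp, Matrix.mulVec_zero] at h2
      exact hene h2.symm
    ext j
    have h3 := congrArg (fun q => Polynomial.coeff q (j : ℕ)) hp0
    simpa [p, Polynomial.finsetSum_coeff, Polynomial.coeff_C_mul, Polynomial.coeff_X_pow,
      Fin.val_inj] using h3
  have hKu : IsUnit K := by
    rw [← Matrix.mulVec_injective_iff_isUnit]
    intro x y hxy
    have := hKinj (x - y) (by rw [Matrix.mulVec_sub]; exact sub_eq_zero.2 hxy)
    exact sub_eq_zero.1 this
  have hMu : IsUnit M₂ := (Matrix.isUnit_iff_isUnit_det _).2 hM₂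
  obtain ⟨k, hk⟩ := hKu
  obtain ⟨u, hu⟩ := hMu
  obtain ⟨P, hP⟩ : ∃ P, P = u * k⁻¹ := ⟨_, rfl⟩
  have hPK : (P : Matrix (Fin m) (Fin m) (ZMod 2)) * K = M₂ := by
    rw [← hk, ← hu, ← Units.val_mul]
    simp [hP]
  have hKe : K.mulVec e = e := by
    have := hKcol ⟨0, hm⟩
    rw [pow_zero, Matrix.one_mulVec] at this
    exact this
  have hv' : v = (P : Matrix (Fin m) (Fin m) (ZMod 2)).mulVec e := by
    rw [← hv, ← hPK, ← Matrix.mulVec_mulVec, hKe]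
  refine ⟨P * B * (P⁻¹ : (Matrix (Fin m) (Fin m) (ZMod 2))ˣ), ?_, ?_⟩
  · have h5 := Matrix.charpoly_units_conj P B
    rw [← h5, Matrix.coe_units_inv]
  · intro j
    rw [Units.conj_pow, hv', Matrix.mulVec_mulVec, mul_assoc, Units.inv_mul, mul_one,
      ← hPK, ← Matrix.mulVec_mulVec, hKcol, Matrix.mulVec_mulVec]
end

section
/- Let M be an m×m matrix over GF(2) whose characteristic polynomial is irreducible and whose multiplicative order (as an element of the monoid of m×m matrices) is 2^m − 1, i.e. whose characteristic polynomial is primitive. Then for any two nonzero row vectors a, b ∈ GF(2)^m there exists an integer i with 0 ≤ i < 2^m − 1 such that a·M^i = b. -/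
theorem aeval_eq_zero_of_vecMul (m : ℕ)
    (M : Matrix (Fin m) (Fin m) (ZMod 2)) (hirr : Irreducible M.charpoly)
    (a : Fin m → ZMod 2) (ha : a ≠ 0) (p : Polynomial (ZMod 2))
    (h : Matrix.vecMul a (Polynomial.aeval M p) = 0) : Polynomial.aeval M p = 0 := by
  rcases (dvd_or_isCoprime _ p hirr).symm with hc | ⟨q, rfl⟩
  · exfalso
    obtain ⟨u, v, huv⟩ := hc
    have h1 := congrArg (Polynomial.aeval M) huv
    rw [mul_comm v p] at h1
    simp only [map_add, map_mul, Matrix.aeval_self_charpoly, mul_zero, zero_add, map_one] at h1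
    apply ha
    rw [← Matrix.vecMul_one a, ← h1, ← Matrix.vecMul_vecMul, h, Matrix.zero_vecMul]
  · rw [map_mul, Matrix.aeval_self_charpoly, zero_mul]

/-- Let `M` be an `m×m` matrix over `GF(2)` whose characteristic polynomial is irreducible
and whose multiplicative order is `2^m - 1` (primitive characteristic polynomial). Then
for any nonzero row vectors `a, b` there is `0 ≤ i < 2^m - 1` with `a·M^i = b`. -/
theorem reachability_of_states (m : ℕ)
    (M : Matrix (Fin m) (Fin m) (ZMod 2)) (hirr : Irreducible M.charpoly)
    (hord : orderOf M = 2 ^ m - 1)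
    (a b : Fin m → ZMod 2) (ha : a ≠ 0) (hb : b ≠ 0) :
    ∃ i : ℕ, i < 2 ^ m - 1 ∧ Matrix.vecMul a (M ^ i) = b := by
  have key := aeval_eq_zero_of_vecMul m M hirr a ha
  have hmaps : ∀ i ∈ Finset.range (2 ^ m - 1),
      Matrix.vecMul a (M ^ i) ∈ (Finset.univ.erase 0 : Finset (Fin m → ZMod 2)) := by
    intro i hi
    rw [Finset.mem_range, ← hord] at hi
    refine Finset.mem_erase.2 ⟨fun h => ha ?_, Finset.mem_univ _⟩
    rw [← Matrix.vecMul_one a, ← pow_orderOf_eq_one M, ← Nat.add_sub_cancel' hi.le, pow_add,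
      ← Matrix.vecMul_vecMul, h, Matrix.zero_vecMul]
  have hinj : Set.InjOn (fun i : ℕ => Matrix.vecMul a (M ^ i))
      (Finset.range (2 ^ m - 1) : Set ℕ) := by
    intro i hi j hj hij
    simp only [Finset.coe_range, ← hord] at hi hj
    have h := key (Polynomial.X ^ i - Polynomial.X ^ j) (by
      simp only [map_sub, map_pow, Polynomial.aeval_X, Matrix.vecMul_sub]
      exact sub_eq_zero.2 hij)
    simp only [map_sub, map_pow, Polynomial.aeval_X] at h
    exact pow_injOn_Iio_orderOf hi hj (sub_eq_zero.1 h)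
  have hs := Finset.surjOn_of_injOn_of_card_le (fun i : ℕ => Matrix.vecMul a (M ^ i)) hmaps hinj
    (by simp [Finset.card_erase_of_mem, ZMod.card])
  obtain ⟨i, hi, h⟩ := hs (Finset.mem_coe.2 (Finset.mem_erase.2 ⟨hb, Finset.mem_univ b⟩))
  exact ⟨i, by simpa using hi, h⟩
end

section
/- Let M be an n×n matrix over GF(2) whose characteristic polynomial f is irreducible, and suppose f has a root α in some finite field F with 2^n elements such that the multiplicative order of α is 2^n − 1 (i.e. f is a primitive polynomial). Then the multiplicative order of M is 2^n − 1, and for every nonzero vector v ∈ GF(2)^n the least positive integer i with M^i·v = v is 2^n − 1; that is, the state sequence c_{k+1} = M·c_k started from any nonzero state has least period 2^n − 1. -/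
/-- Let `M` be an `n×n` matrix over `GF(2)` whose characteristic polynomial `f` is
irreducible and primitive: `f` has a root `α` of multiplicative order `2^n - 1` in a
field `F` with `2^n` elements. Then `orderOf M = 2^n - 1`, and for every nonzero
`v ∈ GF(2)^n` the least positive `i` with `M^i·v = v` is `2^n - 1`: the state sequence
`c_{k+1} = M·c_k` from any nonzero state has least period `2^n - 1`. -/
theorem primitive_charpoly_max_period (n : ℕ) (hn : 0 < n)
    (M : Matrix (Fin n) (Fin n) (ZMod 2)) (f : Polynomial (ZMod 2))
    (hf : f = M.charpoly) (hirr : Irreducible f)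
    (F : Type*) [Field F] [Fintype F] [Algebra (ZMod 2) F]
    (hF : Fintype.card F = 2 ^ n)
    (α : F) (hroot : Polynomial.aeval α f = 0) (hα : orderOf α = 2 ^ n - 1) :
    orderOf M = 2 ^ n - 1 ∧
      ∀ v : Fin n → ZMod 2, v ≠ 0 →
        IsLeast {i : ℕ | 0 < i ∧ (M ^ i).mulVec v = v} (2 ^ n - 1) := by
  have hmonic : f.Monic := hf ▸ M.charpoly_monic
  have hM : Polynomial.aeval M f = 0 := hf ▸ M.aeval_self_charpoly
  have hmin : f = minpoly (ZMod 2) α := minpoly.eq_of_irreducible_of_monic hirr hroot hmonic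
  have h1 : ∀ i : ℕ, α ^ i = 1 → M ^ i = 1 := by
    intro i hi
    have hd : f ∣ Polynomial.X ^ i - 1 := by
      rw [hmin]
      apply minpoly.dvd
      simp [hi]
    obtain ⟨q, hq⟩ := hd
    have h := congrArg (Polynomial.aeval M) hq
    rw [map_mul, hM, zero_mul] at h
    simpa [sub_eq_zero] using h
  have h2 : ∀ (i : ℕ) (v : Fin n → ZMod 2), v ≠ 0 → (M ^ i).mulVec v = v → α ^ i = 1 := by
    intro i v hv hi
    have hd : f ∣ Polynomial.X ^ i - 1 := by
      by_contra hnd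
      obtain ⟨a, b, hab⟩ := (hirr.coprime_iff_not_dvd).2 hnd
      have h := congrArg (Polynomial.aeval M) hab
      rw [map_add, map_mul, map_mul, hM, mul_zero, zero_add] at h
      simp only [map_sub, map_pow, Polynomial.aeval_X, map_one] at h
      apply hv
      have h3 := congrArg (fun A => A.mulVec v) h
      simp only [Matrix.one_mulVec] at h3
      rw [← h3, ← Matrix.mulVec_mulVec, Matrix.sub_mulVec, hi, Matrix.one_mulVec, sub_self,
        Matrix.mulVec_zero]
    obtain ⟨q, hq⟩ := hd
    have h := congrArg (Polynomial.aeval α) hq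
    rw [map_mul, hroot, zero_mul] at h
    simpa [sub_eq_zero] using h
  have hpos : 0 < 2 ^ n - 1 := by
    have : 1 < 2 ^ n := Nat.one_lt_two_pow hn.ne'
    omega
  constructor
  · rw [← hα]
    apply Nat.dvd_antisymm
    · exact orderOf_dvd_of_pow_eq_one (h1 _ (pow_orderOf_eq_one α))
    · apply orderOf_dvd_of_pow_eq_one
      refine h2 _ (fun _ => 1) (fun h => one_ne_zero (congrFun h ⟨0, hn⟩)) ?_
      rw [pow_orderOf_eq_one, Matrix.one_mulVec]
  · intro v hv
    refine ⟨⟨hpos, ?_⟩, ?_⟩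
    · rw [h1 _ (hα ▸ pow_orderOf_eq_one α), Matrix.one_mulVec]
    · rintro i ⟨hi, hiv⟩
      rw [← hα]
      exact orderOf_le_of_pow_eq_one hi (h2 i v hv hiv)
end

section
/- Let f be an irreducible polynomial of degree n over GF(2), let F be a finite field with 2^n elements containing a root α of f, let M be an n×n matrix over GF(2) whose characteristic polynomial is f, and let v be a nonzero row vector in GF(2)^n. Let e_1, …, e_n be natural numbers such that the family (α^(e_1), …, α^(e_n)) is linearly independent over GF(2). Then the family of row vectors (v·M^(e_1), …, v·M^(e_n)) is linearly independent over GF(2), i.e. forms a basis of GF(2)^n. -/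
/-- Let `f` be an irreducible polynomial of degree `n` over `GF(2)` with a root `α` in a
field `F` of `2^n` elements, let `M` be an `n×n` matrix over `GF(2)` with characteristic
polynomial `f`, and let `v ≠ 0` be a row vector. If `e_1, …, e_n` are natural numbers
such that `(α^(e_i))_i` is linearly independent over `GF(2)`, then the row vectors
`(v·M^(e_i))_i` are linearly independent over `GF(2)`, i.e. form a basis of `GF(2)^n`. -/
theorem transfer_linearIndependent (n : ℕ) (hn : 0 < n)
    (f : Polynomial (ZMod 2)) (hdeg : f.natDegree = n) (hirr : Irreducible f)
    (F : Type*) [Field F] [Fintype F] [Algebra (ZMod 2) F]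
    (hF : Fintype.card F = 2 ^ n)
    (α : F) (hroot : Polynomial.aeval α f = 0)
    (M : Matrix (Fin n) (Fin n) (ZMod 2)) (hM : M.charpoly = f)
    (v : Fin n → ZMod 2) (hv : v ≠ 0)
    (e : Fin n → ℕ)
    (hindep : LinearIndependent (ZMod 2) (fun i : Fin n => α ^ (e i))) :
    LinearIndependent (ZMod 2)
      (fun i : Fin n => Matrix.vecMul v (M ^ (e i))) := by
  rw [Fintype.linearIndependent_iff] at hindep ⊢
  intro g hg
  apply hindep g
  let p : Polynomial (ZMod 2) := ∑ i, g i • Polynomial.X ^ (e i)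
  have hpM : Polynomial.aeval M p = ∑ i, g i • M ^ (e i) := by
    simp [p, map_sum]
  have hpα : Polynomial.aeval α p = ∑ i, g i • α ^ (e i) := by
    simp [p, map_sum]
  have hvp : Matrix.vecMul v (Polynomial.aeval M p) = 0 := by
    rw [hpM, Matrix.vecMul_sum, ← hg]
    exact Finset.sum_congr rfl fun i _ => Matrix.vecMul_smul _ _ _
  have hdvd : f ∣ p := by
    by_contra hnd
    obtain ⟨a, b, hab⟩ := (hirr.coprime_iff_not_dvd).2 hnd
    have hfM : Polynomial.aeval M f = 0 := hM ▸ Matrix.aeval_self_charpoly M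
    have h1 : Polynomial.aeval M p * Polynomial.aeval M b = 1 := by
      have h := congrArg (Polynomial.aeval M) hab
      rw [mul_comm b p] at h
      simpa only [map_add, map_mul, hfM, mul_zero, zero_add, map_one] using h
    apply hv
    rw [← Matrix.vecMul_one v, ← h1, ← Matrix.vecMul_vecMul, hvp, Matrix.zero_vecMul]
  rw [← hpα]
  obtain ⟨q, hq⟩ := hdvd
  rw [hq, map_mul, hroot, zero_mul]
end
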